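/- Let w ∈ Ŵ be minuscule and let γ ∈ I_w. Then γ is a generator of the abelian ideal I_w if and only if w(δ − γ) ∈ −Π̂. -/

import Mathlib

open scoped BigOperators

/-- Data of a reduced irreducible crystallographic root system `Δ`, spanning a
`ℚ`-vector space `V` equipped with a Weyl-group-invariant inner product `B`,
together with a chosen system of positive roots `Pos` and the highest root `θ`. -/
structure RootSystemCtx (V : Type*) [AddCommGroup V] [Module ℚ V] where
  /-- the invariant inner product `( , )` -/
  B : V →ₗ[ℚ] V →ₗ[ℚ] ℚ
  B_symm : ∀ x y : V, B x y = B y x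
  B_posdef : ∀ x : V, x ≠ 0 → 0 < B x x
  /-- the set of roots -/
  Δ : Set V
  Δ_finite : Δ.Finite
  Δ_spans : Submodule.span ℚ Δ = ⊤
  zero_notMem_Δ : (0 : V) ∉ Δ
  neg_mem_Δ : ∀ α ∈ Δ, -α ∈ Δ
  reduced : ∀ α ∈ Δ, ∀ c : ℚ, c • α ∈ Δ → c = 1 ∨ c = -1
  crystallographic : ∀ α ∈ Δ, ∀ β ∈ Δ, ∃ n : ℤ, 2 * B α β / B β β = (n : ℚ)
  reflect_mem : ∀ α ∈ Δ, ∀ β ∈ Δ, β - (2 * B β α / B α α) • α ∈ Δ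
  irreducible : ∀ S : Set V, S ⊆ Δ → (∀ α ∈ S, ∀ β ∈ Δ \ S, B α β = 0) → S = ∅ ∨ S = Δ
  /-- the positive roots `Δ⁺` -/
  Pos : Set V
  pos_subset : Pos ⊆ Δ
  mem_pos_or_neg_pos : ∀ α ∈ Δ, α ∈ Pos ∨ -α ∈ Pos
  pos_not_neg : ∀ α ∈ Pos, -α ∉ Pos
  add_pos_mem : ∀ α ∈ Pos, ∀ β ∈ Pos, α + β ∈ Δ → α + β ∈ Pos
  /-- the highest root `θ` -/
  θ : V
  θ_pos : θ ∈ Pos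
  θ_highest : ∀ ν ∈ Δ, θ - ν ∈ AddSubmonoid.closure Pos

namespace RootSystemCtx

variable {V : Type*} [AddCommGroup V] [Module ℚ V] (ctx : RootSystemCtx V)

/-- the simple roots `Π`: indecomposable positive roots -/
def simple : Set V :=
  {α | α ∈ ctx.Pos ∧ ¬∃ β ∈ ctx.Pos, ∃ γ ∈ ctx.Pos, α = β + γ}

/-- `ρ`, the half-sum of all positive roots -/
noncomputable def ρ : V :=
  (1 / 2 : ℚ) • ∑ α ∈ (ctx.Δ_finite.subset ctx.pos_subset).toFinset, α

/-- the coroot `μ∨ = 2μ/(μ,μ)` -/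
noncomputable def coroot (μ : V) : V := (2 / ctx.B μ μ) • μ

/-- `Δ⁺_l`, the long positive roots (roots of the same length as `θ`) -/
def PosLong : Set V := {μ | μ ∈ ctx.Pos ∧ ctx.B μ μ = ctx.B ctx.θ ctx.θ}

/-- `Π_l`, the long simple roots -/
def SimpleLong : Set V := {μ | μ ∈ ctx.simple ∧ ctx.B μ μ = ctx.B ctx.θ ctx.θ}

/-- the dominance order `μ ≼ ν` on the root lattice: `ν - μ` is a nonnegative
integer combination of positive roots -/
def le (μ ν : V) : Prop := ν - μ ∈ AddSubmonoid.closure ctx.Pos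

/-- a (combinatorial) abelian ideal of `Δ⁺` -/
def IsAbelianIdeal (I : Set V) : Prop :=
  I ⊆ ctx.Pos ∧ (∀ μ ∈ I, ∀ ν ∈ I, μ + ν ∉ ctx.Δ) ∧
    ∀ γ ∈ I, ∀ ν ∈ ctx.Pos, γ + ν ∈ ctx.Δ → γ + ν ∈ I

/-- `γ` is a generator of the ideal `I` -/
def IsGenerator (I : Set V) (γ : V) : Prop := γ ∈ I ∧ ∀ α ∈ ctx.Pos, γ - α ∉ I

/-! ### The affine picture: `V̂ = V ⊕ ℚδ ⊕ ℚλ`, modelled as `V × ℚ × ℚ`,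
with `δ = (0,1,0)` and `λ = (0,0,1)`. -/

/-- the embedding of `V` into `V̂` -/
def emb (_ctx : RootSystemCtx V) (v : V) : V × ℚ × ℚ := (v, 0, 0)

/-- the imaginary root `δ` -/
def δhat (_ctx : RootSystemCtx V) : V × ℚ × ℚ := (0, 1, 0)

/-- the affine simple root `α₀ = δ - θ` -/
def alpha0 : V × ℚ × ℚ := (-ctx.θ, 1, 0)

/-- the extension of the inner product to `V̂`, with
`(δ,V)=(λ,V)=(δ,δ)=(λ,λ)=0` and `(δ,λ)=1` -/
noncomputable def Bhat : (V × ℚ × ℚ) →ₗ[ℚ] (V × ℚ × ℚ) →ₗ[ℚ] ℚ :=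
  LinearMap.mk₂ ℚ (fun x y => ctx.B x.1 y.1 + x.2.1 * y.2.2 + x.2.2 * y.2.1)
    (fun x x' y => by
      simp only [Prod.fst_add, Prod.snd_add, map_add, LinearMap.add_apply]; ring)
    (fun c x y => by
      simp only [Prod.smul_fst, Prod.smul_snd, map_smul, LinearMap.smul_apply,
        smul_eq_mul]; ring)
    (fun x y y' => by
      simp only [Prod.fst_add, Prod.snd_add, map_add]; ring)
    (fun c x y => by
      simp only [Prod.smul_fst, Prod.smul_snd, map_smul, smul_eq_mul]; ring)

/-- the set `Δ̂` of affine real roots -/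
def Δhat : Set (V × ℚ × ℚ) := {x | ∃ α ∈ ctx.Δ, ∃ k : ℤ, x = (α, (k : ℚ), 0)}

/-- the set `Δ̂⁺` of positive affine roots -/
def PosHat : Set (V × ℚ × ℚ) :=
  {x | ∃ α ∈ ctx.Pos, x = (α, 0, 0)} ∪
    {x | ∃ α ∈ ctx.Δ, ∃ k : ℤ, 1 ≤ k ∧ x = (α, (k : ℚ), 0)}

/-- the set `Π̂ = Π ∪ {α₀}` of affine simple roots -/
def SimpleHat : Set (V × ℚ × ℚ) :=
  {x | ∃ α ∈ ctx.simple, x = (α, (0 : ℚ), (0 : ℚ))} ∪ {ctx.alpha0}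

/-- the reflection `s_β : x ↦ x − (2(x,β)/(β,β))·β` in `V̂` -/
noncomputable def refl (β : V × ℚ × ℚ) : (V × ℚ × ℚ) ≃ₗ[ℚ] (V × ℚ × ℚ) :=
  if h : ctx.Bhat β β = 0 then LinearEquiv.refl ℚ _
  else
    Module.reflection (x := β) (f := (2 / ctx.Bhat β β) • ctx.Bhat β)
      (by simp only [LinearMap.smul_apply, smul_eq_mul]; field_simp)

/-- the affine Weyl group `Ŵ`, generated by the reflections `s_β`, `β ∈ Δ̂` -/
def What : Subgroup ((V × ℚ × ℚ) ≃ₗ[ℚ] (V × ℚ × ℚ)) :=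
  Subgroup.closure {g | ∃ β ∈ ctx.Δhat, g = ctx.refl β}

/-- the finite Weyl group `W`, generated by the reflections `s_α`, `α ∈ Δ`
(identified with a subgroup of `Ŵ`) -/
def Wfin : Subgroup ((V × ℚ × ℚ) ≃ₗ[ℚ] (V × ℚ × ℚ)) :=
  Subgroup.closure {g | ∃ α ∈ ctx.Δ, g = ctx.refl (α, (0 : ℚ), (0 : ℚ))}

/-- `N̂(w) = {β ∈ Δ̂⁺ : w(β) ∈ −Δ̂⁺}` -/
def Nhat (w : (V × ℚ × ℚ) ≃ₗ[ℚ] (V × ℚ × ℚ)) : Set (V × ℚ × ℚ) :=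
  {β | β ∈ ctx.PosHat ∧ -(w β) ∈ ctx.PosHat}

/-- a minuscule element of `Ŵ`: every element of `N̂(w)` has the form `δ - γ`
with `γ ∈ Δ⁺` -/
def IsMinuscule (w : (V × ℚ × ℚ) ≃ₗ[ℚ] (V × ℚ × ℚ)) : Prop :=
  w ∈ ctx.What ∧ ∀ β ∈ ctx.Nhat w, ∃ γ ∈ ctx.Pos, β = ctx.δhat - ctx.emb γ

/-- the abelian ideal `I_w` corresponding to a minuscule element `w` -/
def idealOf (w : (V × ℚ × ℚ) ≃ₗ[ℚ] (V × ℚ × ℚ)) : Set V :=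
  {γ | γ ∈ ctx.Pos ∧ ctx.δhat - ctx.emb γ ∈ ctx.Nhat w}

/-- the ideal `I` has rootlet `τ(I) = μ`, i.e. `I = I_w` for some minuscule `w`
with `w(α₀) + δ = μ` -/
def HasRootlet (I : Set V) (μ : V) : Prop :=
  ∃ w, ctx.IsMinuscule w ∧ ctx.idealOf w = I ∧ w ctx.alpha0 + ctx.δhat = ctx.emb μ

/-- `Ab_μ`, the set of nonempty abelian ideals with rootlet `μ` -/
def AbFiber (μ : V) : Set (Set V) := {I | I.Nonempty ∧ ctx.HasRootlet I μ}

/-- `N(u) = {γ ∈ Δ⁺ : u(γ) ∈ −Δ⁺}` for `u` in the finite Weyl group -/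
def Nfin (w : (V × ℚ × ℚ) ≃ₗ[ℚ] (V × ℚ × ℚ)) : Set V :=
  {γ | γ ∈ ctx.Pos ∧ -(w (ctx.emb γ)) ∈ ctx.PosHat}

/-- the length `l(u) = #N(u)` of an element of the finite Weyl group -/
noncomputable def lenFin (w : (V × ℚ × ℚ) ≃ₗ[ℚ] (V × ℚ × ℚ)) : ℕ :=
  (ctx.Nfin w).ncard

end RootSystemCtx

namespace RootSystemCtx

variable {V : Type*} [AddCommGroup V] [Module ℚ V] (ctx : RootSystemCtx V)

/-! ### The finite root system -/

theorem ne_zero_of_mem_Δ {α : V} (hα : α ∈ ctx.Δ) : α ≠ 0 :=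
  fun h => ctx.zero_notMem_Δ (h ▸ hα)

theorem B_self_pos {α : V} (hα : α ∈ ctx.Δ) : 0 < ctx.B α α :=
  ctx.B_posdef α (ctx.ne_zero_of_mem_Δ hα)

theorem add_mem_or_eq_zero_of_B_neg {α β : V} (hα : α ∈ ctx.Δ) (hβ : β ∈ ctx.Δ)
    (h : ctx.B α β < 0) : α + β ∈ ctx.Δ ∨ α + β = 0 := by
  have hαα := ctx.B_self_pos hα
  have hββ := ctx.B_self_pos hβ
  have hsymm := ctx.B_symm α β
  obtain ⟨n, hn⟩ := ctx.crystallographic α hα β hβ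
  obtain ⟨m, hm⟩ := ctx.crystallographic β hβ α hα
  have hrn := ctx.reflect_mem β hβ α hα
  have hrm := ctx.reflect_mem α hα β hβ
  rw [hn] at hrn
  rw [hm] at hrm
  rw [div_eq_iff hββ.ne'] at hn
  rw [div_eq_iff hαα.ne'] at hm
  have hn0 : n < 0 := by
    have : (n : ℚ) < 0 := by by_contra! hc; nlinarith
    exact_mod_cast this
  have hm0 : m < 0 := by
    have : (m : ℚ) < 0 := by by_contra! hc; nlinarith
    exact_mod_cast this
  rcases eq_or_ne n (-1) with rfl | hn1
  · left; simpa using hrn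
  rcases eq_or_ne m (-1) with rfl | hm1
  · left; simpa [add_comm] using hrm
  right
  have hn2 : (n : ℚ) ≤ -2 := by exact_mod_cast (by omega : n ≤ -2)
  have hm2 : (m : ℚ) ≤ -2 := by exact_mod_cast (by omega : m ≤ -2)
  by_contra hne
  have hpos := ctx.B_posdef _ hne
  simp only [map_add, LinearMap.add_apply] at hpos
  nlinarith

theorem add_mem_pos_of_B_neg {α β : V} (hα : α ∈ ctx.Pos) (hβ : β ∈ ctx.Pos)
    (h : ctx.B α β < 0) : α + β ∈ ctx.Pos := by
  rcases ctx.add_mem_or_eq_zero_of_B_neg (ctx.pos_subset hα) (ctx.pos_subset hβ) h with h' | h'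
  · exact ctx.add_pos_mem α hα β hβ h'
  · exact absurd (eq_neg_of_add_eq_zero_right h' ▸ hβ) (ctx.pos_not_neg α hα)

theorem multiset_eq_zero_of_sum_eq_zero (s : Multiset V) (hs : ∀ x ∈ s, x ∈ ctx.Pos)
    (hsum : s.sum = 0) : s = 0 := by
  induction hn : Multiset.card s generalizing s with
  | zero => exact Multiset.card_eq_zero.mp hn
  | succ n ih =>
    obtain ⟨a, has⟩ := Multiset.card_pos_iff_exists_mem.mp (by omega : 0 < Multiset.card s)
    obtain ⟨t, rfl⟩ := Multiset.exists_cons_of_mem has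
    have ha : a ∈ ctx.Pos := hs a (Multiset.mem_cons_self a t)
    have hsumB : ctx.B a a + (t.map (ctx.B a)).sum = 0 := by
      have := congrArg (ctx.B a) hsum
      simpa [map_multiset_sum] using this
    obtain ⟨x, hx, hax⟩ : ∃ x ∈ t, ctx.B a x < 0 := by
      by_contra! hc
      have h0 : 0 ≤ (t.map (ctx.B a)).sum := by
        apply Multiset.sum_nonneg
        intro y hy
        obtain ⟨x, hx, rfl⟩ := Multiset.mem_map.mp hy
        exact hc x hx
      linarith [ctx.B_self_pos (ctx.pos_subset ha)]
    obtain ⟨u, rfl⟩ := Multiset.exists_cons_of_mem hx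
    have hcons : ((a + x) ::ₘ u) = 0 := by
      apply ih
      · intro y hy
        rcases Multiset.mem_cons.mp hy with rfl | hy
        · exact ctx.add_mem_pos_of_B_neg ha (hs x (by simp)) hax
        · exact hs y (by simp [hy])
      · simpa [add_assoc] using hsum
      · simpa using hn
    exact absurd hcons (Multiset.cons_ne_zero)

theorem neg_notMem_closure {α : V} (hα : α ∈ ctx.Pos) :
    -α ∉ AddSubmonoid.closure ctx.Pos := by
  intro h
  obtain ⟨s, hs, hsum⟩ := AddSubmonoid.exists_multiset_of_mem_closure h
  have hcons := ctx.multiset_eq_zero_of_sum_eq_zero (α ::ₘ s)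
    (by
      intro y hy
      rcases Multiset.mem_cons.mp hy with rfl | hy
      · exact hα
      · exact hs y hy)
    (by simp [hsum])
  exact Multiset.cons_ne_zero hcons

theorem θ_add_notMem {α : V} (hα : α ∈ ctx.Pos) : ctx.θ + α ∉ ctx.Δ := by
  intro h
  have := ctx.θ_highest _ h
  rw [sub_add_cancel_left] at this
  exact ctx.neg_notMem_closure hα this

theorem B_nonneg_of_mem_closure {η x : V} (hη : ∀ α ∈ ctx.Pos, 0 ≤ ctx.B η α)
    (hx : x ∈ AddSubmonoid.closure ctx.Pos) : 0 ≤ ctx.B η x := by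
  induction hx using AddSubmonoid.closure_induction with
  | mem x hx => exact hη x hx
  | zero => simp
  | add x y _ _ hx hy => rw [map_add]; exact add_nonneg hx hy

/-- A positive root other than `θ` can be raised by adding a positive root. -/
theorem exists_add_mem_of_ne_θ {η : V} (hη : η ∈ ctx.Pos) (hne : η ≠ ctx.θ) :
    ∃ α ∈ ctx.Pos, η + α ∈ ctx.Δ := by
  by_cases hdom : ∀ α ∈ ctx.Pos, 0 ≤ ctx.B η α
  · have hηΔ := ctx.pos_subset hη
    have hθΔ := ctx.pos_subset ctx.θ_pos
    have h0 := ctx.B_nonneg_of_mem_closure hdom (ctx.θ_highest η hηΔ)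
    have h1 := ctx.B_self_pos hηΔ
    rw [map_sub] at h0
    have hneg : ctx.B ctx.θ (-η) < 0 := by
      rw [map_neg, ctx.B_symm]; linarith
    rcases ctx.add_mem_or_eq_zero_of_B_neg hθΔ (ctx.neg_mem_Δ η hηΔ) hneg with h | h
    · rcases ctx.mem_pos_or_neg_pos _ h with h' | h'
      · exact ⟨_, h', by simpa using hθΔ⟩
      · exact absurd (by simpa using hηΔ) (ctx.θ_add_notMem h')
    · exact absurd (by simpa [add_neg_eq_zero, eq_comm] using h) hne
  · push Not at hdom
    obtain ⟨α, hα, hneg⟩ := hdom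
    exact ⟨α, hα, ctx.pos_subset (ctx.add_mem_pos_of_B_neg hη hα hneg)⟩

/-! ### Affine roots -/

theorem posHat_subset_Δhat : ctx.PosHat ⊆ ctx.Δhat := by
  rintro x (⟨α, hα, rfl⟩ | ⟨α, hα, k, -, rfl⟩)
  · exact ⟨α, ctx.pos_subset hα, 0, by simp⟩
  · exact ⟨α, hα, k, rfl⟩

theorem neg_mem_Δhat {x : V × ℚ × ℚ} (hx : x ∈ ctx.Δhat) : -x ∈ ctx.Δhat := by
  obtain ⟨α, hα, k, rfl⟩ := hx
  exact ⟨-α, ctx.neg_mem_Δ α hα, -k, by simp⟩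

theorem mem_posHat_or_neg_mem_posHat {x : V × ℚ × ℚ} (hx : x ∈ ctx.Δhat) :
    x ∈ ctx.PosHat ∨ -x ∈ ctx.PosHat := by
  obtain ⟨α, hα, k, rfl⟩ := hx
  rcases lt_trichotomy k 0 with hk | rfl | hk
  · exact Or.inr (Or.inr ⟨-α, ctx.neg_mem_Δ α hα, -k, by omega, by simp⟩)
  · rcases ctx.mem_pos_or_neg_pos α hα with h | h
    · exact Or.inl (Or.inl ⟨α, h, by simp⟩)
    · exact Or.inr (Or.inl ⟨-α, h, by simp⟩)
  · exact Or.inl (Or.inr ⟨α, hα, k, by omega, rfl⟩)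

theorem Bhat_apply (x y : V × ℚ × ℚ) :
    ctx.Bhat x y = ctx.B x.1 y.1 + x.2.1 * y.2.2 + x.2.2 * y.2.1 := rfl

theorem refl_apply (β x : V × ℚ × ℚ) (h : ctx.Bhat β β ≠ 0) :
    ctx.refl β x = x - (2 / ctx.Bhat β β * ctx.Bhat β x) • β := by
  simp [refl, h, Module.reflection_apply]

theorem refl_mem_Δhat {β x : V × ℚ × ℚ} (hβ : β ∈ ctx.Δhat) (hx : x ∈ ctx.Δhat) :
    ctx.refl β x ∈ ctx.Δhat := by
  obtain ⟨α, hα, k, rfl⟩ := hβ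
  obtain ⟨ξ, hξ, m, rfl⟩ := hx
  have hαα := ctx.B_self_pos hα
  obtain ⟨n, hn⟩ := ctx.crystallographic ξ hξ α hα
  have hr := ctx.reflect_mem α hα ξ hξ
  rw [hn] at hr
  have hcoef : 2 / ctx.B α α * ctx.B α ξ = n := by
    rw [← hn, ctx.B_symm α ξ]; ring
  refine ⟨_, hr, m - n * k, ?_⟩
  rw [refl_apply _ _ _ (by simpa [Bhat_apply] using hαα.ne')]
  simp [Bhat_apply, hcoef]

theorem refl_δhat {β : V × ℚ × ℚ} (hβ : β ∈ ctx.Δhat) : ctx.refl β ctx.δhat = ctx.δhat := by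
  obtain ⟨α, hα, k, rfl⟩ := hβ
  rw [refl_apply _ _ _ (by simpa [Bhat_apply] using (ctx.B_self_pos hα).ne')]
  simp [Bhat_apply, δhat]

theorem refl_refl (β x : V × ℚ × ℚ) : ctx.refl β (ctx.refl β x) = x := by
  unfold refl
  split_ifs with h
  · rfl
  · exact Module.involutive_reflection _ x

theorem refl_inv (β : V × ℚ × ℚ) : (ctx.refl β)⁻¹ = ctx.refl β :=
  inv_eq_of_mul_eq_one_left (LinearEquiv.ext fun x => ctx.refl_refl β x)

theorem What_induction {p : ((V × ℚ × ℚ) ≃ₗ[ℚ] (V × ℚ × ℚ)) → Prop} (h_one : p 1)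
    (h_mul : ∀ β ∈ ctx.Δhat, ∀ g, p g → p (ctx.refl β * g))
    {w : (V × ℚ × ℚ) ≃ₗ[ℚ] (V × ℚ × ℚ)} (hw : w ∈ ctx.What) : p w := by
  induction hw using Subgroup.closure_induction_left with
  | one => exact h_one
  | mul_left x hx y _ ih =>
    obtain ⟨β, hβ, rfl⟩ := hx
    exact h_mul β hβ y ih
  | inv_mul_cancel x hx y _ ih =>
    obtain ⟨β, hβ, rfl⟩ := hx
    rw [refl_inv]
    exact h_mul β hβ y ih

theorem map_mem_Δhat {w : (V × ℚ × ℚ) ≃ₗ[ℚ] (V × ℚ × ℚ)} (hw : w ∈ ctx.What)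
    {x : V × ℚ × ℚ} (hx : x ∈ ctx.Δhat) : w x ∈ ctx.Δhat :=
  ctx.What_induction (p := fun g => g x ∈ ctx.Δhat) hx
    (fun _ hβ _ hg => ctx.refl_mem_Δhat hβ hg) hw

theorem map_δhat {w : (V × ℚ × ℚ) ≃ₗ[ℚ] (V × ℚ × ℚ)} (hw : w ∈ ctx.What) :
    w ctx.δhat = ctx.δhat :=
  ctx.What_induction (p := fun g => g ctx.δhat = ctx.δhat) rfl
    (fun β hβ g hg => by rw [LinearEquiv.mul_apply, hg, ctx.refl_δhat hβ]) hw

theorem symm_map_mem_Δhat {w : (V × ℚ × ℚ) ≃ₗ[ℚ] (V × ℚ × ℚ)} (hw : w ∈ ctx.What)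
    {x : V × ℚ × ℚ} (hx : x ∈ ctx.Δhat) : w.symm x ∈ ctx.Δhat :=
  ctx.map_mem_Δhat (inv_mem hw) hx

/-- Simple affine roots are not sums of two positive affine real roots. -/
theorem add_notMem_simpleHat {x y : V × ℚ × ℚ} (hx : x ∈ ctx.PosHat) (hy : y ∈ ctx.PosHat) :
    x + y ∉ ctx.SimpleHat := by
  have hθ : ∀ α ∈ ctx.Pos, ∀ β ∈ ctx.Δ, α + β ≠ -ctx.θ := by
    intro α hα β hβ h
    apply ctx.θ_add_notMem hα
    have : ctx.θ + α = -β := by rw [← neg_neg ctx.θ, ← h]; abel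
    rw [this]
    exact ctx.neg_mem_Δ β hβ
  rcases hx with ⟨α, hα, rfl⟩ | ⟨α, hα, k, hk, rfl⟩ <;>
  rcases hy with ⟨β, hβ, rfl⟩ | ⟨β, hβ, m, hm, rfl⟩ <;>
  rintro (⟨π, hπ, h⟩ | h) <;>
  simp only [alpha0, Set.mem_singleton_iff, Prod.mk_add_mk, Prod.mk.injEq, add_zero,
    zero_add, and_true] at h
  · exact hπ.2 ⟨α, hα, β, hβ, h.symm⟩
  · exact absurd h.2 (by norm_num)
  · have := h.2; norm_cast at this; omega
  · exact hθ α hα β hβ h.1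
  · have := h.2; norm_cast at this; omega
  · exact hθ β hβ α hα (by rw [add_comm]; exact h.1)
  · have := h.2; norm_cast at this; omega
  · have := h.2; norm_cast at this; omega

/-- A positive affine real root that is not simple is a sum of two positive affine roots,
at least one of them real. -/
theorem exists_decomposition {b : V × ℚ × ℚ} (hb : b ∈ ctx.PosHat) (hns : b ∉ ctx.SimpleHat) :
    (∃ x ∈ ctx.PosHat, ∃ y ∈ ctx.PosHat, b = x + y) ∨
      ∃ x ∈ ctx.PosHat, ∃ k : ℤ, 1 ≤ k ∧ b = x + (k : ℚ) • ctx.δhat := by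
  rcases hb with ⟨α, hα, rfl⟩ | ⟨α, hα, k, hk, rfl⟩
  · left
    have : ¬ α ∈ ctx.simple := fun h => hns (Or.inl ⟨α, h, rfl⟩)
    simp only [simple, Set.mem_ofPred_eq, not_and, not_not] at this
    obtain ⟨β, hβ, γ, hγ, rfl⟩ := this hα
    exact ⟨_, Or.inl ⟨β, hβ, rfl⟩, _, Or.inl ⟨γ, hγ, rfl⟩, by simp⟩
  · rcases hk.eq_or_lt with rfl | hk
    · rcases ctx.mem_pos_or_neg_pos α hα with h | h
      · exact Or.inr ⟨_, Or.inl ⟨α, h, rfl⟩, 1, le_rfl, by simp [δhat]⟩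
      · have hne : -α ≠ ctx.θ := by
          rintro hθ
          apply hns
          right
          simp [alpha0, ← hθ]
        obtain ⟨ξ, hξ, hmem⟩ := ctx.exists_add_mem_of_ne_θ h hne
        refine Or.inl ⟨_, Or.inl ⟨ξ, hξ, rfl⟩, _,
          Or.inr ⟨-(-α + ξ), ctx.neg_mem_Δ _ hmem, 1, le_rfl, rfl⟩, ?_⟩
        simp
    · exact Or.inr ⟨_, Or.inr ⟨α, hα, 1, le_rfl, rfl⟩, k - 1, by omega, by simp [δhat]⟩

/-! ### Minuscule elements -/

variable {ctx} {w : (V × ℚ × ℚ) ≃ₗ[ℚ] (V × ℚ × ℚ)}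

theorem IsMinuscule.map_emb_mem_posHat (hw : ctx.IsMinuscule w) {α : V} (hα : α ∈ ctx.Pos) :
    w (ctx.emb α) ∈ ctx.PosHat := by
  have hpos : ctx.emb α ∈ ctx.PosHat := Or.inl ⟨α, hα, rfl⟩
  rcases ctx.mem_posHat_or_neg_mem_posHat
    (ctx.map_mem_Δhat hw.1 (ctx.posHat_subset_Δhat hpos)) with h | h
  · exact h
  · obtain ⟨γ, -, hγ⟩ := hw.2 _ ⟨hpos, h⟩
    simp [emb, δhat] at hγ

/-- A negative affine root made positive by a minuscule `w` is `γ - δ` for some `γ ∈ I_w`. -/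
theorem IsMinuscule.exists_idealOf (hw : ctx.IsMinuscule w) {x : V × ℚ × ℚ}
    (hx : -x ∈ ctx.PosHat) (hwx : w x ∈ ctx.PosHat) :
    ∃ ν ∈ ctx.idealOf w, x = ctx.emb ν - ctx.δhat := by
  have hN : -x ∈ ctx.Nhat w := ⟨hx, by simpa using hwx⟩
  obtain ⟨ν, hν, h⟩ := hw.2 _ hN
  exact ⟨ν, ⟨hν, h ▸ hN⟩, by rw [← neg_neg x, h, neg_sub]⟩

/-- If `γ ∈ I_w` satisfies `γ - δ = x + y` with `x` negative and `w x`, `w y` positive, then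
`γ` is not a generator. -/
theorem IsMinuscule.not_isGenerator (hw : ctx.IsMinuscule w) {γ : V} {x y : V × ℚ × ℚ}
    (hx : -x ∈ ctx.PosHat) (hwx : w x ∈ ctx.PosHat) (hy : y ∈ ctx.Δhat)
    (hwy : w y ∈ ctx.PosHat) (hxy : ctx.emb γ - ctx.δhat = x + y) :
    ¬ ctx.IsGenerator (ctx.idealOf w) γ := by
  intro hgen
  obtain ⟨ν, hν, rfl⟩ := hw.exists_idealOf hx hwx
  have hyeq : y = ctx.emb (γ - ν) := by
    have : y = ctx.emb γ - ctx.emb ν := by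
      rw [sub_add_eq_add_sub, sub_left_inj] at hxy
      rw [hxy]; abel
    rw [this]
    ext <;> simp [emb]
  rcases ctx.mem_posHat_or_neg_mem_posHat hy with h | h
  · have hpos : γ - ν ∈ ctx.Pos := by
      rw [hyeq] at h
      rcases h with ⟨α, hα, h⟩ | ⟨α, hα, k, hk, h⟩
      · simp only [emb, Prod.mk.injEq, and_true] at h
        exact h ▸ hα
      · simp only [emb, Prod.mk.injEq, and_true] at h
        have := h.2
        norm_cast at this
        omega
    exact hgen.2 _ hpos (by simpa using hν)
  · obtain ⟨μ, -, hμ⟩ := hw.exists_idealOf h hwy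
    rw [hyeq] at hμ
    simp [emb, δhat] at hμ

end RootSystemCtx

/-- Theorem `gener`: for a minuscule `w` and `γ ∈ I_w`, the root
`γ` is a generator of `I_w` if and only if `w(δ − γ) ∈ −Π̂`. -/
theorem statement_1 {V : Type*} [AddCommGroup V] [Module ℚ V] (ctx : RootSystemCtx V)
    (w : (V × ℚ × ℚ) ≃ₗ[ℚ] (V × ℚ × ℚ)) (hw : ctx.IsMinuscule w)
    (γ : V) (hγ : γ ∈ ctx.idealOf w) :
    ctx.IsGenerator (ctx.idealOf w) γ ↔
      -(w (ctx.δhat - ctx.emb γ)) ∈ ctx.SimpleHat := by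
  constructor
  · intro hgen
    by_contra hns
    rcases ctx.exists_decomposition hγ.2.2 hns with ⟨x, hx, y, hy, h⟩ | ⟨x, hx, k, hk, h⟩
    · have hsum : ctx.emb γ - ctx.δhat = w.symm x + w.symm y := by
        rw [← map_add, ← h, map_neg, LinearEquiv.symm_apply_apply, neg_sub]
      have hxΔ := ctx.symm_map_mem_Δhat hw.1 (ctx.posHat_subset_Δhat hx)
      have hyΔ := ctx.symm_map_mem_Δhat hw.1 (ctx.posHat_subset_Δhat hy)
      have hwx : w (w.symm x) ∈ ctx.PosHat := by simpa using hx
      have hwy : w (w.symm y) ∈ ctx.PosHat := by simpa using hy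
      have hnonneg : ∀ z ∈ ctx.PosHat, 0 ≤ z.2.1 := by
        rintro z (⟨α, hα, rfl⟩ | ⟨α, hα, m, hm, rfl⟩)
        · exact le_rfl
        · exact Int.cast_nonneg (by omega : 0 ≤ m)
      rcases ctx.mem_posHat_or_neg_mem_posHat hxΔ with hx' | hx'
      · rcases ctx.mem_posHat_or_neg_mem_posHat hyΔ with hy' | hy'
        · have hlevel := congrArg (fun z : V × ℚ × ℚ => z.2.1) hsum
          simp only [RootSystemCtx.emb, RootSystemCtx.δhat, Prod.snd_sub, Prod.fst_sub,
            Prod.snd_add, Prod.fst_add] at hlevel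
          linarith [hnonneg _ hx', hnonneg _ hy']
        · exact hw.not_isGenerator hy' hwy hxΔ hwx (by rw [hsum, add_comm]) hgen
      · exact hw.not_isGenerator hx' hwx hyΔ hwy hsum hgen
    · have hwz : w (ctx.emb γ - ((k : ℚ) + 1) • ctx.δhat) = x := by
        have hx' : x = -(w (ctx.δhat - ctx.emb γ)) - (k : ℚ) • ctx.δhat := by rw [h]; abel
        rw [hx', map_sub, map_sub, map_smul, ctx.map_δhat hw.1, add_smul, one_smul]
        abel
      have hneg : -(ctx.emb γ - ((k : ℚ) + 1) • ctx.δhat) ∈ ctx.PosHat :=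
        Or.inr ⟨-γ, ctx.neg_mem_Δ γ (ctx.pos_subset hγ.1), k + 1, by omega,
          by simp [RootSystemCtx.emb, RootSystemCtx.δhat]⟩
      obtain ⟨ν, -, hν⟩ := hw.exists_idealOf hneg (by rwa [hwz])
      have hlevel := congrArg (fun z : V × ℚ × ℚ => z.2.1) hν
      simp [RootSystemCtx.emb, RootSystemCtx.δhat] at hlevel
      omega
  · refine fun hsimple => ⟨hγ, fun α hα hmem => ?_⟩
    apply ctx.add_notMem_simpleHat (hw.map_emb_mem_posHat hα) hmem.2.2
    convert hsimple using 1
    rw [← map_neg, ← map_neg, ← map_add]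
    congr 1
    simp [RootSystemCtx.emb, RootSystemCtx.δhat]
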